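/- arXiv:1302.4493 — 4 statements merged into one kernel-verified Lean document; each statement's English description precedes it below -/
import Mathlib

section
/- Let n ≥ 1 and let L : ℝ^n × ℝ^n × ℝ → ℝ, (q,v,t) ↦ L(q,v,t), be twice continuously differentiable. Let γ : ℝ → ℝ^n be twice continuously differentiable and satisfy the Euler–Lagrange equations: for all t, d/dt [∂L/∂v(γ(t), γ'(t), t)] = ∂L/∂q(γ(t), γ'(t), t) (as vectors in ℝ^n). Define the parametrization P : ℝ^n × ℝ^n × ℝ → ℝ^{2n+2} of the Legendre surface Σ by P(q,v,t) = (q, ∂L/∂v(q,v,t), t, ⟨v, ∂L/∂v(q,v,t)⟩ − L(q,v,t)), and let Γ(t) = P(γ(t), γ'(t), t) be the lifted curve. Let ω be the alternating bilinear form on ℝ^{2n+2} = {(q,p,t,E)} given by ω(u,w) = ⟨u_p, w_q⟩ − ⟨u_q, w_p⟩ − (u_E w_t − u_t w_E). Then for every t and every vector w in the range of the Fréchet derivative of P at (γ(t), γ'(t), t), one has ω(Γ'(t), w) = 0. -/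
/-- A point/tangent vector of the extended phase space `ℝ^{2n+2}`, with coordinates
`(q, p, t, E)`. -/
abbrev ExtPhase (n : ℕ) := (Fin n → ℝ) × (Fin n → ℝ) × ℝ × ℝ

/-- The canonical symplectic form `dp∧dq − dE∧dt` on the extended phase space:
`ω(u,w) = ⟨u_p, w_q⟩ − ⟨u_q, w_p⟩ − (u_E·w_t − u_t·w_E)` for
`u = (u_q, u_p, u_t, u_E)`, `w = (w_q, w_p, w_t, w_E)`. -/
noncomputable def symplForm {n : ℕ} (u w : ExtPhase n) : ℝ :=
  (∑ i, u.2.1 i * w.1 i) - (∑ i, u.1 i * w.2.1 i) - (u.2.2.2 * w.2.2.1 - u.2.2.1 * w.2.2.2)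

/-- `∂L/∂v` of `L : (q, v, t) ↦ L(q,v,t)`, as a vector in `ℝ^n`. -/
noncomputable def Lv {n : ℕ} (L : (Fin n → ℝ) × (Fin n → ℝ) × ℝ → ℝ)
    (q v : Fin n → ℝ) (t : ℝ) : Fin n → ℝ :=
  fun i => fderiv ℝ L (q, v, t) (0, Pi.single i 1, 0)

/-- `∂L/∂q` of `L : (q, v, t) ↦ L(q,v,t)`, as a vector in `ℝ^n`. -/
noncomputable def Lq {n : ℕ} (L : (Fin n → ℝ) × (Fin n → ℝ) × ℝ → ℝ)
    (q v : Fin n → ℝ) (t : ℝ) : Fin n → ℝ :=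
  fun i => fderiv ℝ L (q, v, t) (Pi.single i 1, 0, 0)

/-- The parametrization `P(q,v,t) = (q, ∂L/∂v, t, ⟨v, ∂L/∂v⟩ − L)` of the Legendre
surface `Σ` in the extended phase space. -/
noncomputable def legendreMap {n : ℕ} (L : (Fin n → ℝ) × (Fin n → ℝ) × ℝ → ℝ)
    (x : (Fin n → ℝ) × (Fin n → ℝ) × ℝ) : ExtPhase n :=
  (x.1, Lv L x.1 x.2.1 x.2.2, x.2.2,
    (∑ i, x.2.1 i * Lv L x.1 x.2.1 x.2.2 i) - L x)

theorem fderiv_split_aux {n : ℕ} (L : (Fin n → ℝ) × (Fin n → ℝ) × ℝ → ℝ)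
    (q v a b : Fin n → ℝ) (t c : ℝ) :
    fderiv ℝ L (q, v, t) (a, b, c) = (∑ i, a i * Lq L q v t i) + (∑ i, b i * Lv L q v t i)
      + c * fderiv ℝ L (q, v, t) (0, 0, 1) := by
  set D := fderiv ℝ L (q, v, t) with hD
  have h : ((a, b, c) : (Fin n → ℝ) × (Fin n → ℝ) × ℝ) =
      (a, 0, 0) + (0, b, 0) + c • (0, 0, 1) := by simp
  have h1 : D (a, 0, 0) = ∑ i, a i * Lq L q v t i := by
    have := LinearMap.pi_apply_eq_sum_univ
      ((D.comp (ContinuousLinearMap.inl ℝ (Fin n → ℝ) ((Fin n → ℝ) × ℝ))).toLinearMap) a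
    have e : ∀ i : Fin n, (fun j => if i = j then (1:ℝ) else 0) = Pi.single i 1 := by
      intro i; ext j; simp [Pi.single_apply, eq_comm]
    simp [e] at this
    exact this
  have h2 : D (0, b, 0) = ∑ i, b i * Lv L q v t i := by
    have := LinearMap.pi_apply_eq_sum_univ
      ((D.comp ((ContinuousLinearMap.inr ℝ (Fin n → ℝ) ((Fin n → ℝ) × ℝ)).comp
        (ContinuousLinearMap.inl ℝ (Fin n → ℝ) ℝ))).toLinearMap) b
    have e : ∀ i : Fin n, (fun j => if i = j then (1:ℝ) else 0) = Pi.single i 1 := by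
      intro i; ext j; simp [Pi.single_apply, eq_comm]
    simpa [e, Lv, hD] using this
  rw [h, map_add, map_add, map_smul, h1, h2, smul_eq_mul]

/-- the velocity of the lifted extremal curve is a null vector of the
symplectic form restricted to the Legendre surface `Σ`. If `L` is `C²`, `γ` is a `C²`
solution of the Euler–Lagrange equations
`d/dt [∂L/∂v(γ, γ', t)] = ∂L/∂q(γ, γ', t)`, and `Γ(t) = P(γ(t), γ'(t), t)` is the lifted
curve, then for every `t` and every `w` in the range of the Fréchet derivative of `P` at
`(γ(t), γ'(t), t)` (i.e. every tangent vector to `Σ` there), `ω(Γ'(t), w) = 0`. -/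
theorem lifted_curve_null_vector_on_legendre_surface
    (n : ℕ) (hn : 1 ≤ n)
    (L : (Fin n → ℝ) × (Fin n → ℝ) × ℝ → ℝ) (hL : ContDiff ℝ 2 L)
    (γ : ℝ → Fin n → ℝ) (hγ : ContDiff ℝ 2 γ)
    (hEL : ∀ t : ℝ,
      HasDerivAt (fun s => Lv L (γ s) (deriv γ s) s)
        (Lq L (γ t) (deriv γ t) t) t) :
    ∀ t : ℝ, ∀ w ∈ Set.range (fderiv ℝ (legendreMap L) (γ t, deriv γ t, t)),
      symplForm (deriv (fun s => legendreMap L (γ s, deriv γ s, s)) t) w = 0 := by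
  rintro t _ ⟨⟨a, b, c⟩, rfl⟩
  have hLd : Differentiable ℝ L := hL.differentiable (by norm_num)
  have hfd : ContDiff ℝ 1 (fderiv ℝ L) := hL.fderiv_right (by norm_num)
  have hp : Differentiable ℝ
      (fun x : (Fin n → ℝ) × (Fin n → ℝ) × ℝ => Lv L x.1 x.2.1 x.2.2) := by
    rw [differentiable_pi]
    intro i
    exact (hfd.differentiable (by norm_num)).clm_apply (differentiable_const _)
  set x₀ : (Fin n → ℝ) × (Fin n → ℝ) × ℝ := (γ t, deriv γ t, t) with hx₀
  obtain ⟨P', hP'⟩ : ∃ P', HasFDerivAt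
      (fun x : (Fin n → ℝ) × (Fin n → ℝ) × ℝ => Lv L x.1 x.2.1 x.2.2) P' x₀ :=
    ⟨_, (hp x₀).hasFDerivAt⟩
  have hPi := hasFDerivAt_pi'.1 hP'
  have hv : ∀ i, HasFDerivAt (fun x : (Fin n → ℝ) × (Fin n → ℝ) × ℝ => x.2.1 i)
      ((ContinuousLinearMap.proj i).comp ((ContinuousLinearMap.fst ℝ (Fin n → ℝ) ℝ).comp
        (ContinuousLinearMap.snd ℝ (Fin n → ℝ) ((Fin n → ℝ) × ℝ)))) x₀ := fun i =>
    ContinuousLinearMap.hasFDerivAt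
      (((ContinuousLinearMap.proj i : (Fin n → ℝ) →L[ℝ] ℝ)).comp
        ((ContinuousLinearMap.fst ℝ (Fin n → ℝ) ℝ).comp
        (ContinuousLinearMap.snd ℝ (Fin n → ℝ) ((Fin n → ℝ) × ℝ))))
  have hE := (HasFDerivAt.fun_sum (u := Finset.univ)
    (fun i _ => (hv i).mul (hPi i))).sub (hLd x₀).hasFDerivAt
  have hT : HasFDerivAt (fun x : (Fin n → ℝ) × (Fin n → ℝ) × ℝ => x.2.2)
      ((ContinuousLinearMap.snd ℝ (Fin n → ℝ) ℝ).comp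
        (ContinuousLinearMap.snd ℝ (Fin n → ℝ) ((Fin n → ℝ) × ℝ))) x₀ :=
    ContinuousLinearMap.hasFDerivAt ((ContinuousLinearMap.snd ℝ (Fin n → ℝ) ℝ).comp
        (ContinuousLinearMap.snd ℝ (Fin n → ℝ) ((Fin n → ℝ) × ℝ)))
  have hP : HasFDerivAt (legendreMap L) _ x₀ :=
    (hasFDerivAt_fst (𝕜 := ℝ)).prodMk (hP'.prodMk (hT.prodMk hE))
  rw [hP.fderiv]
  have g1 : HasDerivAt γ (deriv γ t) t := (hγ.differentiable (by norm_num) t).hasDerivAt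
  have g2 : HasDerivAt (deriv γ) (deriv (deriv γ) t) t := by
    have : ContDiff ℝ 1 (deriv γ) := ((contDiff_succ_iff_deriv (n := 1)).1 hγ).2.2
    exact (this.differentiable (by norm_num) t).hasDerivAt
  have g3 : HasDerivAt (fun s => (γ s, deriv γ s, s)) (deriv γ t, deriv (deriv γ) t, (1:ℝ)) t :=
    g1.prodMk (g2.prodMk (hasDerivAt_id t))
  have hL' := (hLd x₀).hasFDerivAt.comp_hasDerivAt t g3
  have hE' := (HasDerivAt.fun_sum (u := Finset.univ)
    (fun i _ => ((hasDerivAt_pi.1 g2) i).mul ((hasDerivAt_pi.1 (hEL t)) i))).sub hL'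
  have hG : HasDerivAt (fun s => legendreMap L (γ s, deriv γ s, s)) _ t :=
    g1.prodMk ((hEL t).prodMk ((hasDerivAt_id t).prodMk hE'))
  rw [hG.deriv]
  simp only [symplForm, hx₀]
  simp [Finset.sum_add_distrib, mul_comm]
  rw [fderiv_split_aux L _ _ a b t c, fderiv_split_aux L _ _ (deriv γ t) (deriv (deriv γ) t) t 1]
  simp only [mul_comm]
  ring
end

section
/- Let n ≥ 1 and let L : ℝ^n → ℝ be twice continuously differentiable. Fix τ ≠ 0 and χ ∈ ℝ^n. Define f on {(τ', χ') ∈ ℝ × ℝ^n : τ' ≠ 0} by f(τ', χ') = −E(v')·τ + ⟨∇L(v'), χ⟩, where v' = χ'/τ' and E(v) = ⟨v, ∇L(v)⟩ − L(v). Then the Fréchet derivative of f at the point (τ, χ) is zero. -/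
/-- The gradient of `L : ℝ^n → ℝ` at `v`, with components `∂L/∂vⁱ(v) = fderiv ℝ L v (eᵢ)`. -/
noncomputable def gradL {n : ℕ} (L : (Fin n → ℝ) → ℝ) (v : Fin n → ℝ) : Fin n → ℝ :=
  fun i => fderiv ℝ L v (Pi.single i 1)

/-- The energy `E(v) = ⟨v, ∇L(v)⟩ − L(v)`. -/
noncomputable def energy {n : ℕ} (L : (Fin n → ℝ) → ℝ) (v : Fin n → ℝ) : ℝ :=
  (∑ i, v i * gradL L v i) - L v

theorem sum_gradL {n : ℕ} (L : (Fin n → ℝ) → ℝ) (v w : Fin n → ℝ) :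
    ∑ i, w i * gradL L v i = fderiv ℝ L v w := by
  conv_rhs => rw [pi_eq_sum_univ' w]
  rw [map_sum]
  refine Finset.sum_congr rfl fun i _ => ?_
  rw [map_smul, smul_eq_mul, gradL]

theorem hasFDerivAt_aux {n : ℕ} (L : (Fin n → ℝ) → ℝ) (hL : ContDiff ℝ 2 L) (w : Fin n → ℝ) :
    HasFDerivAt (fun v => L v + fderiv ℝ L v (w - v)) (0 : (Fin n → ℝ) →L[ℝ] ℝ) w := by
  have h1 : HasFDerivAt L (fderiv ℝ L w) w :=
    (hL.differentiable (by norm_num) w).hasFDerivAt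
  have h2 : HasFDerivAt (fderiv ℝ L) (fderiv ℝ (fderiv ℝ L) w) w :=
    ((hL.fderiv_right (m := 1) (by norm_num)).differentiable (by norm_num) w).hasFDerivAt
  have h3 := h1.add (h2.clm_apply ((hasFDerivAt_id w).const_sub w))
  refine h3.congr_fderiv ?_
  ext x
  simp

/-- second defining requirement of the generalized Legendre transformation.
For a `C²` Lagrange function `L : ℝ^n → ℝ`, a fixed velocity `(τ, χ)` with `τ ≠ 0`, and
`f(τ', χ') = ⟨π(τ',χ'), (τ,χ)⟩ = −E(χ'/τ')·τ + ⟨∇L(χ'/τ'), χ⟩` (the pairing of the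
Legendre image of the varied velocity with the fixed velocity), the Fréchet derivative of
`f` at the point `(τ, χ)` is zero. -/
theorem legendre_pairing_extremal
    (n : ℕ) (hn : 1 ≤ n) (L : (Fin n → ℝ) → ℝ) (hL : ContDiff ℝ 2 L)
    (τ : ℝ) (hτ : τ ≠ 0) (χ : Fin n → ℝ) :
    HasFDerivAt
      (fun p : ℝ × (Fin n → ℝ) =>
        -energy L (p.1⁻¹ • p.2) * τ + ∑ i, gradL L (p.1⁻¹ • p.2) i * χ i)
      (0 : ℝ × (Fin n → ℝ) →L[ℝ] ℝ) (τ, χ) := by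
  have hd : DifferentiableAt ℝ (fun p : ℝ × (Fin n → ℝ) => p.1⁻¹ • p.2) (τ, χ) := by
    have h1 : DifferentiableAt ℝ (fun p : ℝ × (Fin n → ℝ) => p.1⁻¹) (τ, χ) :=
      DifferentiableAt.fun_inv differentiableAt_fst hτ
    exact DifferentiableAt.fun_smul h1 differentiableAt_snd
  have h := ((hasFDerivAt_aux L hL (τ⁻¹ • χ)).comp (τ, χ)
    (f := fun p : ℝ × (Fin n → ℝ) => p.1⁻¹ • p.2) hd.hasFDerivAt).mul_const τ
  refine (h.congr_fderiv (by simp)).congr_of_eventuallyEq (Filter.Eventually.of_forall ?_)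
  intro p
  have e : ∑ i, gradL L (p.1⁻¹ • p.2) i * χ i = fderiv ℝ L (p.1⁻¹ • p.2) χ := by
    rw [← sum_gradL]
    exact Finset.sum_congr rfl fun i _ => mul_comm _ _
  simp only [energy, e, sum_gradL, Function.comp, map_sub]
  rw [map_smul _ τ⁻¹ χ, smul_eq_mul]
  field_simp
  ring
end

section
/- Let n ≥ 0, let ǧ be a symmetric invertible (n+1) × (n+1) real matrix, and let Ψ ∈ ℝ. Define F(Λ, X_φ, X) = Λ·X_φ − Ψ·X_φ² − ½·Xᵀǧ X on ℝ × ℝ × ℝ^{n+1}, with gradient ∇F = (X_φ, Λ − 2Ψ·X_φ, −ǧX). Let (Π, P^φ, P) ∈ ℝ × ℝ × ℝ^{n+1} be nonzero. Then the following are equivalent: (a) there exist (Λ, X_φ, X) ≠ 0 and c ≠ 0 with F(Λ, X_φ, X) = 0 and (Π, P^φ, P) = c·∇F(Λ, X_φ, X); (b) Π²·Ψ + Π·P^φ − ½·Pᵀ ǧ⁻¹ P = 0. -/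
open Matrix

/-- Dual variety of the projectivized graph of the scalar-field Lagrange
function in `(n+1)`-dimensional spacetime. For a symmetric invertible matrix `ǧ` and a
constant `Ψ`, a nonzero covector `(Π, P^φ, P)` is proportional (by `c ≠ 0`) to the gradient
`∇F = (X_φ, Λ − 2Ψ·X_φ, −ǧX)` of `F(Λ, X_φ, X) = Λ·X_φ − Ψ·X_φ² − ½·XᵀǧX` at some nonzero
zero of `F` iff `Π²·Ψ + Π·P^φ − ½·Pᵀǧ⁻¹P = 0`. -/
theorem dual_variety_scalar_field_general
    (n : ℕ) (gc : Matrix (Fin (n + 1)) (Fin (n + 1)) ℝ)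
    (hsymm : gc.IsSymm) (hinv : IsUnit gc.det) (Ψ : ℝ)
    (PI Pphi : ℝ) (P : Fin (n + 1) → ℝ) (hP : (PI, Pphi, P) ≠ (0, 0, 0)) :
    (∃ (L Xphi : ℝ) (X : Fin (n + 1) → ℝ), (L, Xphi, X) ≠ (0, 0, 0) ∧ ∃ c : ℝ, c ≠ 0 ∧
        L * Xphi - Ψ * Xphi ^ 2 - (1 / 2) * (X ⬝ᵥ gc.mulVec X) = 0 ∧
        PI = c * Xphi ∧ Pphi = c * (L - 2 * Ψ * Xphi) ∧ P = c • (-(gc.mulVec X)))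
      ↔ PI ^ 2 * Ψ + PI * Pphi - (1 / 2) * (P ⬝ᵥ gc⁻¹.mulVec P) = 0 := by
  constructor
  · rintro ⟨L, Xphi, X, -, c, hc, hF, rfl, rfl, rfl⟩
    have h1 : gc⁻¹.mulVec (c • (-(gc.mulVec X))) = c • (-X) := by
      rw [Matrix.mulVec_smul, Matrix.mulVec_neg, Matrix.mulVec_mulVec,
        Matrix.nonsing_inv_mul _ hinv, Matrix.one_mulVec]
    rw [h1, smul_dotProduct, dotProduct_smul, neg_dotProduct_neg, dotProduct_comm]
    simp only [smul_eq_mul]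
    linear_combination c ^ 2 * hF
  · intro h
    have h1 : gc.mulVec (-(gc⁻¹.mulVec P)) = -P := by
      rw [Matrix.mulVec_neg, Matrix.mulVec_mulVec,
        Matrix.mul_nonsing_inv _ hinv, Matrix.one_mulVec]
    refine ⟨Pphi + 2 * Ψ * PI, PI, -(gc⁻¹.mulVec P), ?_, 1, one_ne_zero, ?_, ?_, ?_, ?_⟩
    · intro h0
      simp only [Prod.mk.injEq] at h0
      obtain ⟨ha, hb, hd⟩ := h0
      apply hP
      rw [hd, Matrix.mulVec_zero] at h1
      have hp : P = 0 := neg_eq_zero.mp h1.symm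
      subst hb
      have : Pphi = 0 := by linarith
      rw [this, hp]
    · rw [h1, neg_dotProduct_neg, dotProduct_comm]
      linear_combination h
    · ring
    · ring
    · rw [h1]; simp
end

section
/- Let n ≥ 0, let g be a symmetric invertible (n+1) × (n+1) real matrix with entries g^{ij} and inverse entries g_{ij}, and set ǧ_{ij} = (−1)^{i+j} g_{ij}. Let φ : ℝ^{n+1} → ℝ be twice continuously differentiable, let Ψ : ℝ^{n+1} × ℝ → ℝ, (x,u) ↦ Ψ(x,u), be continuously differentiable, and define Pⁱ(x) = (−1)ⁱ ∑_j g^{ij} ∂φ/∂x^j (x) for i = 0, ..., n and P^φ(x) = −½ ∑_{i,j} ǧ_{ij} Pⁱ(x) Pʲ(x) + Ψ(x, φ(x)). Suppose that at every x: ∑_k (−1)^k ∂P^k/∂x^k (x) = ∂Ψ/∂u (x, φ(x)). Then at every x and for every index k: ∂P^φ/∂x^k (x) − ∂Ψ/∂x^k (x, φ(x)) + ∑_i (−1)ⁱ [ (∂Pⁱ/∂x^k)(∂φ/∂x^i) − (∂Pⁱ/∂x^i)(∂φ/∂x^k) ] (x) = 0. -/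
/-- redundancy of the degeneration equations along the spacetime directions
`∂/∂x^k` for a scalar field on `(n+1)`-dimensional spacetime. With `g` symmetric invertible,
`ǧ_{ij} = (−1)^{i+j} g_{ij}` (where `g_{ij}` are the entries of `g⁻¹`), polymomenta
`Pⁱ = (−1)ⁱ ∑_j g^{ij} ∂_jφ` and `P^φ = −½ ∑ ǧ_{ij} Pⁱ Pʲ + Ψ(x, φ(x))`, if
`∑_k (−1)^k ∂_k P^k = ∂Ψ/∂u (x, φ(x))` everywhere, then for every `x` and `k`:
`∂_k P^φ − ∂Ψ/∂x^k + ∑_i (−1)ⁱ [(∂_k Pⁱ)(∂_iφ) − (∂_i Pⁱ)(∂_kφ)] = 0`.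
Here `∂_k f` at `x` is `fderiv ℝ f x (Pi.single k 1)`, `∂Ψ/∂x^k` at `(x,u)` is
`fderiv ℝ Ψ (x,u) (Pi.single k 1, 0)` and `∂Ψ/∂u` is `fderiv ℝ Ψ (x,u) (0, 1)`. -/
theorem spacetime_hamilton_equations_redundant
    (n : ℕ) (g : Matrix (Fin (n + 1)) (Fin (n + 1)) ℝ)
    (hgsymm : g.IsSymm) (hginv : IsUnit g.det)
    (φ : (Fin (n + 1) → ℝ) → ℝ) (hφ : ContDiff ℝ 2 φ)
    (Ψ : (Fin (n + 1) → ℝ) × ℝ → ℝ) (hΨ : ContDiff ℝ 1 Ψ)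
    (gc : Matrix (Fin (n + 1)) (Fin (n + 1)) ℝ)
    (hgc : ∀ i j, gc i j = (-1 : ℝ) ^ ((i : ℕ) + (j : ℕ)) * g⁻¹ i j)
    (P : Fin (n + 1) → (Fin (n + 1) → ℝ) → ℝ)
    (hP : ∀ (x : Fin (n + 1) → ℝ) (i : Fin (n + 1)),
      P i x = (-1 : ℝ) ^ (i : ℕ) * ∑ j : Fin (n + 1), g i j * fderiv ℝ φ x (Pi.single j 1))
    (Pphi : (Fin (n + 1) → ℝ) → ℝ)
    (hPphi : ∀ x : Fin (n + 1) → ℝ,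
      Pphi x = -(1 / 2) * (∑ i : Fin (n + 1), ∑ j : Fin (n + 1), gc i j * P i x * P j x)
        + Ψ (x, φ x))
    (h2 : ∀ x : Fin (n + 1) → ℝ,
      ∑ k : Fin (n + 1), (-1 : ℝ) ^ (k : ℕ) * fderiv ℝ (P k) x (Pi.single k 1)
        = fderiv ℝ Ψ (x, φ x) (0, 1)) :
    ∀ (x : Fin (n + 1) → ℝ) (k : Fin (n + 1)),
      fderiv ℝ Pphi x (Pi.single k 1)
        - fderiv ℝ Ψ (x, φ x) (Pi.single k 1, 0)
        + ∑ i : Fin (n + 1), (-1 : ℝ) ^ (i : ℕ) *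
            (fderiv ℝ (P i) x (Pi.single k 1) * fderiv ℝ φ x (Pi.single i 1)
              - fderiv ℝ (P i) x (Pi.single i 1) * fderiv ℝ φ x (Pi.single k 1)) = 0 := by
  intro x k
  have hdφ : Differentiable ℝ φ := hφ.differentiable (by norm_num)
  have hdΨ : Differentiable ℝ Ψ := hΨ.differentiable (by norm_num)
  have hd2 : Differentiable ℝ (fderiv ℝ φ) :=
    (hφ.fderiv_right (m := 1) (by norm_num)).differentiable (by norm_num)
  have hdP : ∀ i, Differentiable ℝ (P i) := by
    intro i
    have : P i = fun x => (-1 : ℝ) ^ (i : ℕ) *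
        ∑ j : Fin (n + 1), g i j * fderiv ℝ φ x (Pi.single j 1) := funext fun x => hP x i
    rw [this]
    fun_prop
  -- lowering the index
  have hlow : ∀ i, ∑ j, gc i j * P j x = (-1 : ℝ) ^ (i : ℕ) * fderiv ℝ φ x (Pi.single i 1) := by
    intro i
    have hv : (g⁻¹).mulVec (g.mulVec fun l => fderiv ℝ φ x (Pi.single l 1))
        = fun l => fderiv ℝ φ x (Pi.single l 1) := by
      rw [Matrix.mulVec_mulVec, Matrix.nonsing_inv_mul g hginv, Matrix.one_mulVec]
    have hvi := congrFun hv i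
    simp only [Matrix.mulVec, dotProduct] at hvi
    rw [← hvi, Finset.mul_sum]
    refine Finset.sum_congr rfl fun j _ => ?_
    rw [hgc, hP, pow_add]
    have hs : (-1 : ℝ) ^ (j : ℕ) * (-1 : ℝ) ^ (j : ℕ) = 1 := by
      rw [← mul_pow]; norm_num
    linear_combination ((-1 : ℝ) ^ (i : ℕ) * g⁻¹ i j *
      ∑ l, g j l * fderiv ℝ φ x (Pi.single l 1)) * hs
  have hsym : ∀ i j, gc i j = gc j i := by
    intro i j
    have h : (g⁻¹).IsSymm := by
      unfold Matrix.IsSymm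
      rw [Matrix.transpose_nonsing_inv, hgsymm.eq]
    rw [hgc, hgc, add_comm, h.apply]
  have hD : fderiv ℝ Pphi x (Pi.single k 1) =
      -(1 / 2) * (∑ i, ∑ j, (gc i j * fderiv ℝ (P i) x (Pi.single k 1) * P j x
        + gc i j * P i x * fderiv ℝ (P j) x (Pi.single k 1)))
      + fderiv ℝ Ψ (x, φ x) (Pi.single k 1, fderiv ℝ φ x (Pi.single k 1)) := by
    have hf : Pphi = fun x => -(1 / 2) * (∑ i, ∑ j, gc i j * P i x * P j x) + Ψ (x, φ x) :=
      funext hPphi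
    have h1 : HasFDerivAt (fun x => Ψ (x, φ x)) _ x :=
      (hdΨ (x, φ x)).hasFDerivAt.comp x ((hasFDerivAt_id x).prodMk (hdφ x).hasFDerivAt)
    have h3 : HasFDerivAt (fun x => ∑ i, ∑ j, gc i j * P i x * P j x) _ x :=
      HasFDerivAt.fun_sum fun i _ => HasFDerivAt.fun_sum fun j _ =>
        (((hdP i x).hasFDerivAt.const_mul (gc i j)).mul (hdP j x).hasFDerivAt)
    have h4 := ((h3.const_mul (-(1 / 2))).add h1).fderiv
    rw [hf]
    refine (congrArg (fun L => L (Pi.single k 1)) h4).trans ?_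
    simp only [ContinuousLinearMap.add_apply, ContinuousLinearMap.smul_apply,
      ContinuousLinearMap.sum_apply, smul_eq_mul, ContinuousLinearMap.comp_apply,
      ContinuousLinearMap.prod_apply, ContinuousLinearMap.id_apply]
    congr 2
    refine Finset.sum_congr rfl fun i _ => Finset.sum_congr rfl fun j _ => ?_
    ring
  have hsplit : fderiv ℝ Ψ (x, φ x) (Pi.single k 1, fderiv ℝ φ x (Pi.single k 1)) =
      fderiv ℝ Ψ (x, φ x) (Pi.single k 1, 0)
        + fderiv ℝ φ x (Pi.single k 1) * fderiv ℝ Ψ (x, φ x) (0, 1) := by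
    rw [← smul_eq_mul, ← map_smul, ← map_add]
    simp
  have hA : ∑ i, ∑ j, gc i j * fderiv ℝ (P i) x (Pi.single k 1) * P j x =
      ∑ i : Fin (n + 1), (-1 : ℝ) ^ (i : ℕ) *
        (fderiv ℝ (P i) x (Pi.single k 1) * fderiv ℝ φ x (Pi.single i 1)) := by
    refine Finset.sum_congr rfl fun i _ => ?_
    have : (-1 : ℝ) ^ (i : ℕ) *
        (fderiv ℝ (P i) x (Pi.single k 1) * fderiv ℝ φ x (Pi.single i 1)) =
        fderiv ℝ (P i) x (Pi.single k 1) * ∑ j, gc i j * P j x := by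
      rw [hlow]; ring
    rw [this, Finset.mul_sum]
    exact Finset.sum_congr rfl fun j _ => by ring
  have hB : ∑ i, ∑ j, gc i j * P i x * fderiv ℝ (P j) x (Pi.single k 1) =
      ∑ i, ∑ j, gc i j * fderiv ℝ (P i) x (Pi.single k 1) * P j x := by
    rw [Finset.sum_comm]
    refine Finset.sum_congr rfl fun i _ => Finset.sum_congr rfl fun j _ => ?_
    rw [hsym j i]; ring
  have hC : ∑ i : Fin (n + 1), (-1 : ℝ) ^ (i : ℕ) *
      (fderiv ℝ (P i) x (Pi.single i 1) * fderiv ℝ φ x (Pi.single k 1)) =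
      fderiv ℝ φ x (Pi.single k 1) * fderiv ℝ Ψ (x, φ x) (0, 1) := by
    rw [← h2, Finset.mul_sum]
    exact Finset.sum_congr rfl fun j _ => by ring
  rw [hD, hsplit]
  simp only [Finset.sum_add_distrib, mul_sub, Finset.sum_sub_distrib]
  rw [hB, hA, hC]
  ring
end
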